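/- For the model filiform Lie superalgebra L_{n,m} in characteristic zero, with D_k the operator -X_0· on Λ^k I* where I = span{X_1,...,X_n, Y_1,...,Y_m}, one has dim Ker D_k = Σ_{k_0=0}^{k} f_{n,m}(k_0, k-k_0), where f_{n,m}(a,b) counts tuples 1 ≤ i_1 < ... < i_a ≤ n, 1 ≤ j_1 < ... < j_b ≤ m+b-1 with Σ i_s + Σ j_t = ⌊(a(n+1)+b(m+1))/2⌋ + b(b-1)/2. -/

import Mathlib

open scoped Classical
open Finset

noncomputable section

namespace SuperCE

variable (F : Type*) [Field F] {B : Type*} [Fintype B] [DecidableEq B]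

/-- Cochains of the super Chevalley–Eilenberg complex with trivial coefficients:
finitely supported families of coefficients indexed by exponent vectors of monomials in
the dual generators (exterior in duals of even basis vectors, polynomial in duals of odd
basis vectors). -/
abbrev Cochain (F : Type*) [Field F] (B : Type*) := (B → ℕ) →₀ F

variable (p ord : B → ℕ) (c : B → B → B → F)

/-- exponent vector of a single dual generator -/
def eps (b : B) : B → ℕ := fun x => if x = b then 1 else 0

/-- cohomological (`ℤ`-) degree of a monomial -/
def deg (μ : B → ℕ) : ℕ := ∑ b, μ b

/-- admissible exponent vectors: duals of even basis vectors are exterior generators -/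
def IsAdm (μ : B → ℕ) : Prop := ∀ b, p b = 0 → μ b ≤ 1

/-- Koszul sign for multiplying the ordered monomial with exponent vector `μ` by the one
with exponent vector `ν`: two dual generators supercommute, i.e. anticommute except that a
pair of generators dual to odd basis vectors commutes. -/
def sgnProd (μ ν : B → ℕ) : F :=
  (-1 : F) ^ (∑ b1, ∑ b2, if ord b2 < ord b1 then μ b1 * ν b2 * (1 + p b1 * p b2) else 0)

/-- the supercommutative product of cochains (wedge/polynomial multiplication) -/
def Pmul (f g : Cochain F B) : Cochain F B :=
  f.sum fun μ a => g.sum fun ν b' =>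
    if IsAdm p (fun x => μ x + ν x) then
      Finsupp.single (fun x => μ x + ν x) (a * b' * sgnProd F p ord μ ν)
    else 0

/-- coefficients of the differential on a dual generator `x_b*`, namely
`d(x_b*) = ∑_{k<l} (-1)^{|x_k||x_l|} c k l b x_k* x_l* - (1/2) ∑_{k odd} c k k b x_k*²`,
where `c k l b` is the structure constant of the Lie superalgebra. -/
def dcoef (b k l : B) : F :=
  if ord k < ord l then (-1 : F) ^ (p k * p l) * c k l b
  else if k = l ∧ p k = 1 then -((2 : F)⁻¹) * c k k b
  else 0

/-- target exponent vector obtained from `μ` by differentiating the generator `b`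
into the pair `(k, l)` -/
def tgt (μ : B → ℕ) (b k l : B) : B → ℕ :=
  fun x => μ x - eps b x + eps k x + eps l x

/-- the Chevalley–Eilenberg differential of a single monomial, obtained by extending `d`
on generators as a `ℤ`-degree `+1`, parity-even superderivation (Koszul signs included) -/
def dMono (μ : B → ℕ) : Cochain F B :=
  ∑ b, ∑ k, ∑ l,
    if μ b ≠ 0 ∧ IsAdm p (tgt μ b k l) then
      Finsupp.single (tgt μ b k l)
        (((-1 : F) ^ (∑ b', if ord b' < ord b then μ b' else 0)) *
         (μ b : F) * ((-1 : F) ^ ((μ b - 1) * p b)) *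
         ((-1 : F) ^ (p b * ∑ b'', if ord b < ord b'' then μ b'' * p b'' else 0)) *
         dcoef F p ord c b k l *
         sgnProd F p ord (fun x => μ x - eps b x) (fun x => eps k x + eps l x))
    else 0

/-- the Chevalley–Eilenberg differential with trivial coefficients -/
def d : Cochain F B →ₗ[F] Cochain F B :=
  Finsupp.lsum F fun μ => LinearMap.toSpanSingleton F (Cochain F B) (dMono F p ord c μ)

/-- cochains supported on admissible monomials of cohomological degree `k`,
i.e. the `k`-th term `Λᵏ g*` of the super Chevalley–Eilenberg complex -/
def AdmDeg (k : ℕ) : Submodule F (Cochain F B) where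
  carrier := {f | ∀ μ, f μ ≠ 0 → IsAdm p μ ∧ deg μ = k}
  add_mem' := by
    intro f g hf hg μ hμ
    by_cases h1 : f μ = 0
    · exact hg μ (by simpa [Finsupp.add_apply, h1] using hμ)
    · exact hf μ h1
  zero_mem' := by intro μ hμ; simp at hμ
  smul_mem' := by
    intro a f hf μ hμ
    exact hf μ (fun h0 => hμ (by simp [Finsupp.smul_apply, h0]))

/-- cochains supported on admissible monomials (of any degree), i.e. `Λ• g*` -/
def AdmAll : Submodule F (Cochain F B) where
  carrier := {f | ∀ μ, f μ ≠ 0 → IsAdm p μ}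
  add_mem' := by
    intro f g hf hg μ hμ
    by_cases h1 : f μ = 0
    · exact hg μ (by simpa [Finsupp.add_apply, h1] using hμ)
    · exact hf μ h1
  zero_mem' := by intro μ hμ; simp at hμ
  smul_mem' := by
    intro a f hf μ hμ
    exact hf μ (fun h0 => hμ (by simp [Finsupp.smul_apply, h0]))

/-- degree-`k` cocycles -/
def Zk (k : ℕ) : Submodule F (Cochain F B) :=
  AdmDeg F p k ⊓ LinearMap.ker (d F p ord c)

/-- degree-`k` coboundaries -/
def Bk (k : ℕ) : Submodule F (Cochain F B) :=
  Submodule.map (d F p ord c) (AdmDeg F p (k - 1))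

/-- the dimension (Betti number) of the `k`-th Lie superalgebra cohomology
`H^k = Z^k / B^k` with trivial coefficients -/
def Hdim (k : ℕ) : ℕ :=
  Module.finrank F ↥(Zk F p ord c k) -
    Module.finrank F ↥(Bk F p ord c k ⊓ Zk F p ord c k)

end SuperCE

end

noncomputable section
namespace SuperCE
variable (F : Type*) [Field F] {B : Type*} [Fintype B] [DecidableEq B]
variable (p ord : B → ℕ) (c : B → B → B → F)
open Finset

/-- the image monomial of `μ` under replacing one occurrence of the generator `b`
by the generator `j` -/
def Dtgt (μ : B → ℕ) (b j : B) : B → ℕ := fun x => μ x - eps b x + eps j x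

/-- minus the natural action of the basis vector `b0` on a single monomial of `Λ• g*`:
the even derivation determined on generators by `D(x_b*) = ∑_j c b0 j b x_j*` -/
def DMono (b0 : B) (μ : B → ℕ) : Cochain F B :=
  ∑ b, ∑ j,
    if μ b ≠ 0 ∧ IsAdm p (Dtgt μ b j) then
      Finsupp.single (Dtgt μ b j)
        ((μ b : F) * c b0 j b *
         ((-1 : F) ^ (∑ b'', if ord b < ord b'' then (μ b'' - eps b b'') * (1 + p j * p b'') else 0)) *
         ((-1 : F) ^ (∑ b1, if ord j < ord b1 then (μ b1 - eps b b1) * (1 + p b1 * p j) else 0)))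
    else 0

/-- the operator `D : x ↦ -X₀ · x` on cochains -/
def D (b0 : B) : Cochain F B →ₗ[F] Cochain F B :=
  Finsupp.lsum F fun μ => LinearMap.toSpanSingleton F (Cochain F B) (DMono F p ord c b0 μ)

/-- cochains supported on monomials not involving the dual generator of `b0` -/
def NoB0 (b0 : B) : Submodule F (Cochain F B) where
  carrier := {f | ∀ μ, f μ ≠ 0 → μ b0 = 0}
  add_mem' := by
    intro f g hf hg μ hμ
    by_cases h1 : f μ = 0
    · exact hg μ (by simpa [Finsupp.add_apply, h1] using hμ)
    · exact hf μ h1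
  zero_mem' := by intro μ hμ; simp at hμ
  smul_mem' := by
    intro a f hf μ hμ
    exact hf μ (fun h0 => hμ (by simp [Finsupp.smul_apply, h0]))

/-- `Λᵏ I*` : degree-`k` cochains on the ideal spanned by the basis vectors other than `b0` -/
def IDeg (b0 : B) (k : ℕ) : Submodule F (Cochain F B) := AdmDeg F p k ⊓ NoB0 F b0

/-- kernel of `D` on `Λᵏ I*` -/
def KerD (b0 : B) (k : ℕ) : Submodule F (Cochain F B) :=
  IDeg F p b0 k ⊓ LinearMap.ker (D F p ord c b0)

/-- the dimension of `Λᵏ I* / Im D_k` -/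
def CoimD (b0 : B) (k : ℕ) : ℕ :=
  Module.finrank F ↥(IDeg F p b0 k) -
    Module.finrank F
      ↥(Submodule.map (D F p ord c b0) (IDeg F p b0 k) ⊓ IDeg F p b0 k)

end SuperCE
end

noncomputable section
namespace Paper
open SuperCE

/-- parity of the standard basis of the model filiform Lie superalgebra `L_{n,m}`:
`X_0, …, X_n` are even, `Y_1, …, Y_m` are odd -/
def pL (n m : ℕ) : Fin (n + 1) ⊕ Fin m → ℕ := Sum.elim (fun _ => 0) (fun _ => 1)

/-- ordering of the standard basis of `L_{n,m}` -/
def ordL (n m : ℕ) : Fin (n + 1) ⊕ Fin m → ℕ :=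
  Sum.elim (fun i => (i : ℕ)) (fun j => (n + 1) + (j : ℕ))

/-- structure constants of the model filiform Lie superalgebra `L_{n,m}`:
`[X_0, X_i] = X_{i+1}` for `1 ≤ i ≤ n-1` and `[X_0, Y_j] = Y_{j+1}` for `1 ≤ j ≤ m-1`
(here `Sum.inl i` is `X_i` and `Sum.inr j` is `Y_{j+1}`), extended skew-supersymmetrically,
all other brackets of basis vectors being zero. -/
def cL (F : Type*) [Field F] (n m : ℕ) :
    (Fin (n + 1) ⊕ Fin m) → (Fin (n + 1) ⊕ Fin m) → (Fin (n + 1) ⊕ Fin m) → F :=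
  fun a b t =>
    match a, b, t with
    | Sum.inl i, Sum.inl j, Sum.inl k =>
        if (i : ℕ) = 0 ∧ 1 ≤ (j : ℕ) ∧ (j : ℕ) + 1 ≤ n ∧ (k : ℕ) = (j : ℕ) + 1 then 1
        else if (j : ℕ) = 0 ∧ 1 ≤ (i : ℕ) ∧ (i : ℕ) + 1 ≤ n ∧ (k : ℕ) = (i : ℕ) + 1 then -1
        else 0
    | Sum.inl i, Sum.inr j, Sum.inr k =>
        if (i : ℕ) = 0 ∧ (j : ℕ) + 2 ≤ m ∧ (k : ℕ) = (j : ℕ) + 1 then 1 else 0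
    | Sum.inr j, Sum.inl i, Sum.inr k =>
        if (i : ℕ) = 0 ∧ (j : ℕ) + 2 ≤ m ∧ (k : ℕ) = (j : ℕ) + 1 then -1 else 0
    | _, _, _ => 0

end Paper
end

noncomputable section
namespace Paper
open Finset

/-- the combinatorial count `f_{n,m}(a,b)`: the number of tuples
`1 ≤ i_1 < … < i_a ≤ n`, `1 ≤ j_1 < … < j_b ≤ m+b-1` with
`∑ i_s + ∑ j_t = ⌊(a(n+1)+b(m+1))/2⌋ + b(b-1)/2`. -/
def fnm (n m a b : ℕ) : ℕ :=
  ((((Finset.Icc 1 n).powersetCard a) ×ˢ ((Finset.Icc 1 (m + b - 1)).powersetCard b)).filter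
    (fun st => st.1.sum id + st.2.sum id =
      (a * (n + 1) + b * (m + 1)) / 2 + b * (b - 1) / 2)).card

end Paper
end

namespace SlTwo
open Module

variable {F M ι : Type*} [Field F] [CharZero F] [AddCommGroup M] [Module F M]

lemma nonneg_of_eigenvector [FiniteDimensional F M] {h e f : End F M}
    (hef : e * f - f * e = h) (hhe : h * e - e * h = 2 • e) (hhf : h * f - f * h = -(2 • f))
    {v : M} (hv : v ≠ 0) (hev : e v = 0) {w : ℤ} (hw : h v = (w : F) • v) : 0 ≤ w := by
  by_cases h0 : h = 0
  · have : (w : F) • v = 0 := by rw [← hw, h0]; rfl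
    have : (w : F) = 0 := (smul_eq_zero.1 this).resolve_right hv
    exact (Int.cast_eq_zero.1 this).ge
  · let _ : LieRing (End F M) := LieRing.ofAssociativeRing
    have t : IsSl2Triple h e f := ⟨h0, hef, hhe, hhf⟩
    have P : t.HasPrimitiveVectorWith v (w : F) := ⟨hv, hw, hev⟩
    obtain ⟨k, hk⟩ := P.exists_nat
    have : w = k := by exact_mod_cast hk
    omega

lemma weight_eq_of_repr_ne_zero (b : Basis ι F M) {h e : End F M} {wt : ι → ℤ}
    (hhe : h * e - e * h = 2 • e) (hb : ∀ i, h (b i) = (wt i : F) • b i) {i j : ι}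
    (hij : b.repr (e (b i)) j ≠ 0) : wt j = wt i + 2 := by
  have hrepr : ∀ v, b.repr (h v) j = wt j * b.repr v j := by
    intro v
    have : (b.coord j) ∘ₗ h = (wt j : F) • b.coord j := by
      refine b.ext fun k => ?_
      by_cases hk : k = j
      · subst hk; simp [hb]
      · simp [hb, hk]
    simpa using LinearMap.congr_fun this v
  have key := congrArg (fun T : End F M => b.repr (T (b i)) j) hhe
  simp only [LinearMap.sub_apply, Module.End.mul_apply, hb, map_smul, map_sub, two_smul,
    Finsupp.sub_apply, hrepr, Finsupp.smul_apply, smul_eq_mul, LinearMap.add_apply, map_add,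
    Finsupp.add_apply] at key
  have : ((wt j : F) - wt i - 2) * b.repr (e (b i)) j = 0 := by linear_combination key
  have := (mul_eq_zero.1 this).resolve_right hij
  have h2 : (wt j : F) = ((wt i + 2 : ℤ) : F) := by push_cast; linear_combination this
  exact_mod_cast h2

variable [Fintype ι]

lemma repr_eq_zero_of_mem_ker (b : Basis ι F M) {h e f : End F M} {wt : ι → ℤ}
    (hef : e * f - f * e = h) (hhe : h * e - e * h = 2 • e) (hhf : h * f - f * h = -(2 • f))
    (hb : ∀ i, h (b i) = (wt i : F) • b i) {v : M} (hev : e v = 0) {i : ι} (hi : wt i < 0) :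
    b.repr v i = 0 := by
  have : FiniteDimensional F M := b.finiteDimensional_of_finite
  let pr : ℤ → End F M := fun w => b.constr F fun j => if wt j = w then b j else 0
  have hpr : ∀ w j, pr w (b j) = if wt j = w then b j else 0 := fun w j => by
    simp only [pr, Basis.constr_basis]
  have hprr : ∀ w j u, b.repr (pr w u) j = if wt j = w then b.repr u j else 0 := by
    intro w j u
    have : b.coord j ∘ₗ pr w = if wt j = w then b.coord j else 0 := by
      refine b.ext fun k => ?_
      by_cases hk : k = j
      · subst hk; simp only [LinearMap.comp_apply, hpr]; split_ifs <;> simp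
      · simp only [LinearMap.comp_apply, hpr]; split_ifs <;> simp [hk]
    have := LinearMap.congr_fun this u
    simp only [LinearMap.comp_apply, Basis.coord_apply] at this
    rw [this]; split_ifs <;> simp
  have hcomm : ∀ w, e ∘ₗ pr w = pr (w + 2) ∘ₗ e := by
    intro w
    refine b.ext fun j => b.ext_elem fun k => ?_
    simp only [LinearMap.comp_apply, hpr, hprr]
    by_cases hk : b.repr (e (b j)) k = 0
    · split_ifs <;> simp [hk]
    · have := weight_eq_of_repr_ne_zero b hhe hb hk
      simp only [this, add_left_inj]
      split_ifs <;> simp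
  have hpi : e (pr (wt i) v) = 0 := by
    have := LinearMap.congr_fun (hcomm (wt i)) v
    simpa [hev] using this
  have hhpr : ∀ w, h ∘ₗ pr w = (w : F) • pr w := by
    intro w
    refine b.ext fun j => ?_
    simp only [LinearMap.comp_apply, hpr, LinearMap.smul_apply]
    split_ifs with hj
    · rw [hb, hj]
    · simp
  by_contra hne
  have hv : pr (wt i) v ≠ 0 := by
    intro h0
    have := hprr (wt i) i v
    simp [h0] at this
    exact hne this.symm
  have := nonneg_of_eigenvector hef hhe hhf hv hpi (LinearMap.congr_fun (hhpr (wt i)) v)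
  omega

lemma basis_mem_range (b : Basis ι F M) {h e f : End F M} {wt : ι → ℤ}
    (hef : e * f - f * e = h) (hhe : h * e - e * h = 2 • e) (hhf : h * f - f * h = -(2 • f))
    (hb : ∀ i, h (b i) = (wt i : F) • b i) {i : ι} (hi : 0 < wt i) :
    b i ∈ LinearMap.range e := by
  have : FiniteDimensional F M := b.finiteDimensional_of_finite
  rw [← Subspace.dualAnnihilator_dualCoannihilator_eq (W := LinearMap.range e),
    Submodule.mem_dualCoannihilator]
  intro φ hφ
  rw [← LinearMap.ker_dualMap_eq_dualAnnihilator_range, LinearMap.mem_ker] at hφ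
  have := repr_eq_zero_of_mem_ker (M := Dual F M) b.dualBasis (h := -h.dualMap) (e := e.dualMap)
    (f := f.dualMap) (wt := fun j => -wt j) ?_ ?_ ?_ ?_ hφ (i := i) (by simpa using hi)
  · simpa using this
  · rw [← hef]; ext φ x; simp [Module.End.mul_apply]
  · have h2 := congrArg LinearMap.dualMap hhe
    ext φ x
    have := LinearMap.congr_fun (LinearMap.congr_fun h2 φ) x
    simp [Module.End.mul_apply] at this ⊢
    linear_combination this
  · have h2 := congrArg LinearMap.dualMap hhf
    ext φ x
    have := LinearMap.congr_fun (LinearMap.congr_fun h2 φ) x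
    simp [Module.End.mul_apply] at this ⊢
    linear_combination this
  · intro j
    refine b.ext fun k => ?_
    by_cases hk : k = j
    · subst hk; simp [hb]
    · simp [hb, hk]

theorem finrank_ker (b : Basis ι F M) {h e f : End F M} {wt : ι → ℤ}
    (hef : e * f - f * e = h) (hhe : h * e - e * h = 2 • e) (hhf : h * f - f * h = -(2 • f))
    (hb : ∀ i, h (b i) = (wt i : F) • b i) :
    finrank F (LinearMap.ker e) = #{i | wt i = 0 ∨ wt i = 1} := by
  have : FiniteDimensional F M := b.finiteDimensional_of_finite
  let W : ℤ → Submodule F M := fun w => Submodule.span F (b '' {i | w ≤ wt i})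
  have hmem : ∀ w v, v ∈ W w ↔ ∀ i, wt i < w → b.repr v i = 0 := by
    intro w v
    simp only [W, b.mem_span_image, Set.subset_def, Finset.mem_coe, Finsupp.mem_support_iff,
      Set.mem_ofPred_eq]
    refine forall_congr' fun i => ?_
    rw [← not_le, not_imp_comm]
  have hrank : ∀ w, finrank F (W w) = #{i | w ≤ wt i} := by
    intro w
    have : W w = Submodule.span F (Set.range (b ∘ fun i : {i // w ≤ wt i} => i.1)) := by
      simp only [W]; congr 1; ext; simp
    rw [this, finrank_span_eq_card (b.linearIndependent.comp _ Subtype.val_injective),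
      Fintype.card_subtype]
  have hsum : ∀ v j, b.repr (e v) j = ∑ i, b.repr v i * b.repr (e (b i)) j := by
    intro v j
    conv_lhs => rw [← b.sum_repr v]
    simp only [map_sum, map_smul, Finsupp.coe_finsetSum, Finset.sum_apply, Finsupp.smul_apply,
      smul_eq_mul]
  have hker : LinearMap.ker e ≤ W 0 := fun v hv =>
    (hmem 0 v).2 fun i hi => repr_eq_zero_of_mem_ker b hef hhe hhf hb hv hi
  have hmap : (W 0).map e = W 2 := by
    apply le_antisymm
    · rw [Submodule.map_le_iff_le_comap]
      intro v hv
      rw [hmem] at hv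
      rw [Submodule.mem_comap, hmem]
      intro j hj
      rw [hsum]
      refine Finset.sum_eq_zero fun i _ => ?_
      by_contra hne
      have := weight_eq_of_repr_ne_zero b hhe hb (right_ne_zero_of_mul hne)
      exact left_ne_zero_of_mul hne (hv i (by omega))
    · refine Submodule.span_le.2 ?_
      rintro _ ⟨i, hi, rfl⟩
      have hi : 2 ≤ wt i := hi
      obtain ⟨v, hv⟩ := basis_mem_range b hef hhe hhf hb (i := i) (by omega)
      let u := b.equivFun.symm fun j => if 0 ≤ wt j then b.repr v j else 0
      have hu : ∀ j, b.repr u j = if 0 ≤ wt j then b.repr v j else 0 := fun j => by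
        rw [← b.equivFun_apply, LinearEquiv.apply_symm_apply]
      refine ⟨u, (hmem 0 u).2 fun j hj => by rw [hu, if_neg (by omega)], ?_⟩
      refine b.ext_elem fun j => ?_
      by_cases hj : wt j < 2
      · have hji : i ≠ j := by rintro rfl; omega
        rw [b.repr_self, Finsupp.single_eq_of_ne' hji, hsum]
        refine Finset.sum_eq_zero fun k _ => ?_
        by_contra hne
        have := weight_eq_of_repr_ne_zero b hhe hb (right_ne_zero_of_mul hne)
        exact left_ne_zero_of_mul hne (by rw [hu, if_neg (by omega)])
      · rw [← hv, hsum, hsum]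
        refine Finset.sum_congr rfl fun k _ => ?_
        by_cases hne : b.repr (e (b k)) j = 0
        · simp [hne]
        · have := weight_eq_of_repr_ne_zero b hhe hb hne
          rw [hu, if_pos (by omega)]
  have h1 := LinearMap.finrank_range_add_finrank_ker (e.domRestrict (W 0))
  rw [LinearMap.range_domRestrict, hmap, hrank, hrank, LinearMap.ker_domRestrict,
    (Submodule.comapSubtypeEquivOfLe hker).finrank_eq] at h1
  have h2 : #{i | 0 ≤ wt i} = #{i | 2 ≤ wt i} + #{i | wt i = 0 ∨ wt i = 1} := by
    rw [← Finset.card_union_of_disjoint]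
    · congr 1; ext i; simp; omega
    · rw [Finset.disjoint_filter]; intro i _; omega
  omega

/-- the version of `finrank_ker` for an invariant submodule -/
theorem finrank_inf_ker {S : Submodule F M} (b : Basis ι F S) {h e f : M →ₗ[F] M} {wt : ι → ℤ}
    (he : ∀ x ∈ S, e x ∈ S) (hf : ∀ x ∈ S, f x ∈ S) (hh : ∀ x ∈ S, h x ∈ S)
    (hef : ∀ i, e (f (b i)) - f (e (b i)) = h (b i))
    (hhe : ∀ i, h (e (b i)) - e (h (b i)) = (2 : F) • e (b i))
    (hhf : ∀ i, h (f (b i)) - f (h (b i)) = -((2 : F) • f (b i)))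
    (hb : ∀ i, h (b i) = (wt i : F) • (b i : M)) :
    finrank F ↥(S ⊓ LinearMap.ker e) = #{i | wt i = 0 ∨ wt i = 1} := by
  rw [← finrank_ker b (h := h.restrict hh) (e := e.restrict he) (f := f.restrict hf) (wt := wt),
    LinearMap.ker_restrict, ← Submodule.map_comap_subtype,
    Submodule.finrank_map_subtype_eq]
  · exact b.ext fun i => Subtype.ext (by simpa using hef i)
  · exact b.ext fun i => Subtype.ext (by simpa [two_smul] using hhe i)
  · exact b.ext fun i => Subtype.ext (by simpa [two_smul] using hhf i)
  · exact fun i => Subtype.ext (by simpa using hb i)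

end SlTwo

namespace SuperCE
variable {F : Type*} [Field F] {B : Type*} {p : B → ℕ}

lemma sum_Dtgt_mul [Fintype B] [DecidableEq B] (g : B → ℤ) {μ : B → ℕ} {b : B} (j : B)
    (hb : μ b ≠ 0) :
    ∑ x, (Dtgt μ b j x : ℤ) * g x = ∑ x, (μ x : ℤ) * g x - g b + g j := by
  have h : ∀ x, (Dtgt μ b j x : ℤ) * g x =
      μ x * g x - (if x = b then g x else 0) + if x = j then g x else 0 := by
    intro x
    have : (Dtgt μ b j x : ℤ) = μ x - (if x = b then 1 else 0) + if x = j then 1 else 0 := by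
      simp only [Dtgt, eps]
      by_cases hx : x = b
      · subst hx; split_ifs <;> omega
      · simp only [hx, if_false]; split_ifs <;> simp
    rw [this]
    split_ifs <;> ring
  simp [h, Finset.sum_add_distrib]

lemma deg_Dtgt [Fintype B] [DecidableEq B] {μ : B → ℕ} {b : B} (j : B) (hb : μ b ≠ 0) :
    deg (Dtgt μ b j) = deg μ := by
  have := sum_Dtgt_mul (fun _ => 1) j hb
  simp only [mul_one, sub_add_cancel] at this
  exact_mod_cast this

lemma isAdm_Dtgt_iff [DecidableEq B] {μ : B → ℕ} {b j : B} (hμ : IsAdm p μ) (hbj : b ≠ j) :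
    IsAdm p (Dtgt μ b j) ↔ (p j = 0 → μ j = 0) := by
  constructor
  · intro h hj
    have := h j hj
    simp only [Dtgt, eps, if_true, hbj.symm, if_false] at this
    omega
  · intro h x hx
    have := hμ x hx
    by_cases hxj : x = j
    · subst hxj
      simp [Dtgt, eps, h hx]
    · simp only [Dtgt, eps, hxj, if_false]
      omega

noncomputable section

/-- the operator replacing one occurrence of the generator `b` by the generator `j` -/
def hop [DecidableEq B] (F : Type*) [Field F] (p : B → ℕ) (b j : B) :
    Cochain F B →ₗ[F] Cochain F B :=
  Finsupp.lsum F fun μ => LinearMap.toSpanSingleton F (Cochain F B)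
    (if IsAdm p (Dtgt μ b j) then Finsupp.single (Dtgt μ b j) (μ b : F) else 0)

/-- the operator acting on monomials diagonally with eigenvalues `wt` -/
def diag (F : Type*) [Field F] (wt : (B → ℕ) → ℤ) : Cochain F B →ₗ[F] Cochain F B :=
  Finsupp.lsum F fun μ => LinearMap.toSpanSingleton F (Cochain F B) (Finsupp.single μ (wt μ : F))

end

lemma hop_single [DecidableEq B] (b j : B) (μ : B → ℕ) (a : F) :
    hop F p b j (Finsupp.single μ a) =
      if IsAdm p (Dtgt μ b j) then Finsupp.single (Dtgt μ b j) (a * μ b) else 0 := by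
  simp [hop, LinearMap.toSpanSingleton_apply]

lemma diag_single (wt : (B → ℕ) → ℤ) (μ : B → ℕ) (a : F) :
    diag F wt (Finsupp.single μ a) = Finsupp.single μ (a * wt μ) := by
  simp [diag, LinearMap.toSpanSingleton_apply]

lemma hop_hop_single [DecidableEq B] {μ : B → ℕ} {b j b' j' : B} (hμ : IsAdm p μ) (hbj : b ≠ j)
    (hbj' : b' ≠ j') :
    hop F p b' j' (hop F p b j (Finsupp.single μ 1)) =
      if (p j = 0 → μ j = 0) ∧ (p j' = 0 → Dtgt μ b j j' = 0) then
        Finsupp.single (Dtgt (Dtgt μ b j) b' j') ((μ b * Dtgt μ b j b' : ℕ) : F)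
      else 0 := by
  rw [hop_single]
  by_cases h1 : IsAdm p (Dtgt μ b j)
  · have h1' := (isAdm_Dtgt_iff hμ hbj).1 h1
    simp only [if_pos h1, hop_single, isAdm_Dtgt_iff h1 hbj', one_mul, Nat.cast_mul]
    refine if_congr ?_ rfl rfl
    exact ⟨fun h => ⟨h1', h⟩, And.right⟩
  · have h1' := h1
    rw [isAdm_Dtgt_iff hμ hbj] at h1'
    simp [h1, h1']

lemma ite_single_congr {C C' : Prop} [Decidable C] [Decidable C'] {x y : B → ℕ} {a a' : ℕ}
    (h1 : C ∧ a ≠ 0 ↔ C' ∧ a' ≠ 0) (h2 : C → C' → a ≠ 0 → a = a' ∧ x = y) :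
    (if C then Finsupp.single x (a : F) else 0) =
      if C' then Finsupp.single y (a' : F) else 0 := by
  by_cases ha : C ∧ a ≠ 0
  · obtain ⟨rfl, rfl⟩ := h2 ha.1 (h1.1 ha).1 ha.2
    rw [if_pos ha.1, if_pos (h1.1 ha).1]
  · have ha' := mt h1.2 ha
    trans 0
    · split_ifs with h
      · have : a = 0 := by tauto
        simp [this]
      · rfl
    · split_ifs with h
      · have : a' = 0 := by tauto
        simp [this]
      · rfl

lemma hop_commute_single [DecidableEq B] {μ : B → ℕ} {s t s' t' : B} (hμ : IsAdm p μ) (hst : s ≠ t)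
    (hst' : s' ≠ t') (hs : s ≠ s') (ht : t ≠ t') (hp : p s = p t) (hp' : p s' = p t') :
    hop F p t s (hop F p s' t' (Finsupp.single μ 1)) =
      hop F p s' t' (hop F p t s (Finsupp.single μ 1)) := by
  rw [hop_hop_single hμ hst' hst.symm, hop_hop_single hμ hst.symm hst']
  have e1 := hμ s
  have e2 := hμ t
  have e3 := hμ s'
  have e4 := hμ t'
  apply ite_single_congr
  · simp only [Dtgt, eps]
    grind
  · intro h1 h2 h3
    refine ⟨?_, ?_⟩
    · simp only [Dtgt, eps] at *
      grind
    · funext x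
      simp only [Dtgt, eps] at *
      grind

lemma hop_commutator_single [DecidableEq B] {μ : B → ℕ} {s t : B} (hμ : IsAdm p μ) (hst : s ≠ t)
    (hp : p s = p t) :
    hop F p t s (hop F p s t (Finsupp.single μ 1)) -
      hop F p s t (hop F p t s (Finsupp.single μ 1)) =
      Finsupp.single μ ((μ s - μ t : ℤ) : F) := by
  rw [hop_hop_single hμ hst hst.symm, hop_hop_single hμ hst.symm hst]
  have e1 := hμ s
  have e2 := hμ t
  have D1 : Dtgt μ s t s = μ s - 1 := by simp [Dtgt, eps, hst]
  have D2 : Dtgt μ s t t = μ t + 1 := by simp [Dtgt, eps, hst.symm]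
  have D3 : Dtgt μ t s s = μ s + 1 := by simp [Dtgt, eps, hst]
  have D4 : Dtgt μ t s t = μ t - 1 := by simp [Dtgt, eps, hst.symm]
  have T1 : μ s ≠ 0 → Dtgt (Dtgt μ s t) t s = μ := by
    intro h; funext x; simp only [Dtgt, eps]; grind
  have T2 : μ t ≠ 0 → Dtgt (Dtgt μ t s) s t = μ := by
    intro h; funext x; simp only [Dtgt, eps]; grind
  rw [D1, D2, D3, D4]
  have F1 : ∀ a : ℕ, Finsupp.single (Dtgt (Dtgt μ s t) t s) ((μ s * a : ℕ) : F) =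
      Finsupp.single μ ((μ s * a : ℕ) : F) := by
    intro a
    by_cases h : μ s = 0
    · simp [h]
    · rw [T1 h]
  have F2 : ∀ a : ℕ, Finsupp.single (Dtgt (Dtgt μ t s) s t) ((μ t * a : ℕ) : F) =
      Finsupp.single μ ((μ t * a : ℕ) : F) := by
    intro a
    by_cases h : μ t = 0
    · simp [h]
    · rw [T2 h]
  rw [F1, F2]
  by_cases h0 : p s = 0
  · have h0' : p t = 0 := hp ▸ h0
    have a1 := e1 h0
    have a2 := e2 h0'
    interval_cases μ s <;> interval_cases μ t <;> simp [h0, h0']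
  · have h0' : p t ≠ 0 := hp ▸ h0
    simp only [h0, h0', false_imp_iff, and_self, if_true]
    rw [← Finsupp.single_sub]
    push_cast
    congr 1
    ring

lemma linearMap_mem_IDeg [Fintype B] {k : ℕ} {b0 : B} {T : Cochain F B →ₗ[F] Cochain F B}
    (hT : ∀ μ, IsAdm p μ → deg μ = k → μ b0 = 0 → T (Finsupp.single μ 1) ∈ IDeg F p b0 k)
    (f : Cochain F B) (hf : f ∈ IDeg F p b0 k) : T f ∈ IDeg F p b0 k := by
  rw [← Finsupp.sum_single f, Finsupp.sum, map_sum]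
  refine Submodule.sum_mem _ fun μ hμ => ?_
  rw [Finsupp.mem_support_iff] at hμ
  have h1 := hf.1 μ hμ
  rw [← mul_one (f μ), ← smul_eq_mul, ← Finsupp.smul_single, map_smul]
  exact Submodule.smul_mem _ _ (hT μ h1.1 h1.2 (hf.2 μ hμ))

lemma single_mem_IDeg [Fintype B] {k : ℕ} {b0 : B} {μ : B → ℕ} (a : F)
    (h1 : IsAdm p μ) (h2 : deg μ = k) (h3 : μ b0 = 0) : Finsupp.single μ a ∈ IDeg F p b0 k := by
  refine ⟨fun ν hν => ?_, fun ν hν => ?_⟩ <;>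
  · rw [Finsupp.single_apply] at hν
    have : μ = ν := by by_contra h; simp [h] at hν
    subst this
    first | exact ⟨h1, h2⟩ | exact h3

lemma hop_single_mem_IDeg [Fintype B] [DecidableEq B] {k : ℕ} {b0 b j : B} {μ : B → ℕ}
    (hj : j ≠ b0) (h2 : deg μ = k) (h3 : μ b0 = 0) : hop F p b j (Finsupp.single μ 1) ∈ IDeg F p b0 k := by
  rw [hop_single]
  split_ifs with h
  · by_cases hb : μ b = 0
    · simp [hb]
    · refine single_mem_IDeg _ h (by rw [deg_Dtgt j hb, h2]) ?_
      simp [Dtgt, eps, hj.symm, h3]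
  · exact Submodule.zero_mem _

lemma IDeg_eq_supported [Fintype B] (b0 : B) (k : ℕ) :
    IDeg F p b0 k = Finsupp.supported F F {μ | IsAdm p μ ∧ deg μ = k ∧ μ b0 = 0} := by
  ext f
  simp only [Finsupp.mem_supported, Set.subset_def, Finset.mem_coe, Finsupp.mem_support_iff]
  constructor
  · intro h μ hμ
    exact ⟨(h.1 μ hμ).1, (h.1 μ hμ).2, h.2 μ hμ⟩
  · intro h
    exact ⟨fun μ hμ => ⟨(h μ hμ).1, (h μ hμ).2.1⟩, fun μ hμ => (h μ hμ).2.2⟩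

noncomputable section

/-- the monomial basis of `Λᵏ I*` -/
def monomialBasis [Fintype B] (F : Type*) [Field F] (p : B → ℕ) (b0 : B) (k : ℕ) :
    Module.Basis {μ : B → ℕ | IsAdm p μ ∧ deg μ = k ∧ μ b0 = 0} F (IDeg F p b0 k) :=
  Module.Basis.ofRepr ((LinearEquiv.ofEq _ _ (IDeg_eq_supported b0 k)).trans
    (Finsupp.supportedEquivFinsupp _))

end

lemma coe_monomialBasis [Fintype B] (b0 : B) (k : ℕ) (i) :
    (monomialBasis F p b0 k i : Cochain F B) = Finsupp.single i.1 1 := by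
  simp [monomialBasis]

lemma finite_monomials [Fintype B] (b0 : B) (k : ℕ) :
    {μ : B → ℕ | IsAdm p μ ∧ deg μ = k ∧ μ b0 = 0}.Finite := by
  refine (Set.finite_Iic (fun _ : B => k)).subset ?_
  rintro μ ⟨-, h, -⟩ b
  rw [← h]
  exact Finset.single_le_sum (f := μ) (fun _ _ => Nat.zero_le _) (Finset.mem_univ b)

end SuperCE

namespace Paper
open SuperCE Finset

variable {F : Type*} [Field F] {n m : ℕ}

/-- the position of a basis vector in its Jordan block for `ad X₀` -/
def pos (n m : ℕ) : Fin (n + 1) ⊕ Fin m → ℕ := Sum.elim (fun i => i) (fun j => j + 1)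

/-- the length of the Jordan block for `ad X₀` containing a basis vector -/
def len (n m : ℕ) : Fin (n + 1) ⊕ Fin m → ℕ := Sum.elim (fun _ => n) (fun _ => m)

/-- the relation `[X₀, s] = t` between basis vectors -/
def Arrow (n m : ℕ) (s t : Fin (n + 1) ⊕ Fin m) : Prop :=
  pL n m s = pL n m t ∧ pos n m t = pos n m s + 1 ∧ 1 ≤ pos n m s

lemma eq_of_pL_of_pos {s t : Fin (n + 1) ⊕ Fin m} (h1 : pL n m s = pL n m t)
    (h2 : pos n m s = pos n m t) : s = t := by
  rcases s with i | i <;> rcases t with j | j <;> simp_all [pL, pos, Fin.ext_iff]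

lemma len_eq_of_pL {s t : Fin (n + 1) ⊕ Fin m} (h1 : pL n m s = pL n m t) :
    len n m s = len n m t := by
  rcases s with i | i <;> rcases t with j | j <;> simp_all [pL, len]

lemma Arrow.ne {s t : Fin (n + 1) ⊕ Fin m} (h : Arrow n m s t) : s ≠ t := by
  rintro rfl
  have := h.2.1
  omega

lemma Arrow.source_ne {s t : Fin (n + 1) ⊕ Fin m} (h : Arrow n m s t) : s ≠ Sum.inl 0 := by
  rintro rfl
  have := h.2.2
  simp [pos] at this

lemma Arrow.target_ne {s t : Fin (n + 1) ⊕ Fin m} (h : Arrow n m s t) : t ≠ Sum.inl 0 := by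
  rintro rfl
  have := h.2.1
  simp [pos] at this

lemma Arrow.source_eq_iff {s t s' t' : Fin (n + 1) ⊕ Fin m} (h : Arrow n m s t)
    (h' : Arrow n m s' t') : s = s' ↔ t = t' := by
  obtain ⟨a1, a2, a3⟩ := h
  obtain ⟨b1, b2, b3⟩ := h'
  constructor
  · rintro rfl
    exact eq_of_pL_of_pos (by rw [← a1, b1]) (by omega)
  · rintro rfl
    exact eq_of_pL_of_pos (by rw [a1, b1]) (by omega)

lemma cL_eq (s t : Fin (n + 1) ⊕ Fin m) :
    cL F n m (Sum.inl 0) s t = if Arrow n m s t then 1 else 0 := by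
  rcases s with i | i <;> rcases t with j | j
  · have : ¬ ((i : ℕ) = 0 ∧ 1 ≤ ((0 : Fin (n + 1)) : ℕ) ∧
        ((0 : Fin (n + 1)) : ℕ) + 1 ≤ n ∧ (j : ℕ) = ((0 : Fin (n + 1)) : ℕ) + 1) := by simp
    simp only [cL, this, if_false, Arrow, pL, pos, Sum.elim_inl]
    refine if_congr ?_ rfl rfl
    have := j.2
    simp
    omega
  · simp [cL, Arrow, pL]
  · simp [cL, Arrow, pL]
  · simp only [cL, Arrow, pL, pos, Sum.elim_inr]
    refine if_congr ?_ rfl rfl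
    have := j.2
    simp
    omega

lemma ordL_injective : Function.Injective (ordL n m) := by
  intro s t h
  rcases s with i | i <;> rcases t with j | j <;>
    simp only [ordL, Sum.elim_inl, Sum.elim_inr] at h
  · exact congrArg _ (Fin.ext h)
  · have := i.2; omega
  · have := j.2; omega
  · exact congrArg _ (Fin.ext (by omega))

lemma Arrow.ordL_eq {s t : Fin (n + 1) ⊕ Fin m} (h : Arrow n m s t) :
    ordL n m t = ordL n m s + 1 := by
  obtain ⟨h1, h2, h3⟩ := h
  rcases s with i | i <;> rcases t with j | j <;> simp_all [pL, pos, ordL]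
  omega

lemma Arrow.koszul_sign {s t : Fin (n + 1) ⊕ Fin m} (h : Arrow n m s t)
    {μ : Fin (n + 1) ⊕ Fin m → ℕ} (hμ : IsAdm (pL n m) μ) :
    ((-1 : F) ^ (∑ b, if ordL n m t < ordL n m b then
        (μ b - eps t b) * (1 + pL n m s * pL n m b) else 0)) *
      ((-1 : F) ^ (∑ b, if ordL n m s < ordL n m b then
        (μ b - eps t b) * (1 + pL n m b * pL n m s) else 0)) = 1 := by
  have hterm : ∀ b, (if ordL n m s < ordL n m b then
        (μ b - eps t b) * (1 + pL n m b * pL n m s) else 0) =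
      (if ordL n m t < ordL n m b then (μ b - eps t b) * (1 + pL n m s * pL n m b) else 0) +
      if b = t then (μ t - 1) * (1 + pL n m t * pL n m t) else 0 := by
    intro b
    have ho := h.ordL_eq
    by_cases hb : b = t
    · subst hb
      rw [if_pos (by omega), if_neg (by omega), if_pos rfl, h.1, zero_add]
      simp [eps]
    · have : ordL n m b ≠ ordL n m t := fun h => hb (ordL_injective h)
      rw [if_neg hb, add_zero]
      refine if_congr (by omega) ?_ rfl
      rw [mul_comm (pL n m b)]
  simp only [hterm, Finset.sum_add_distrib, Finset.sum_ite_eq', Finset.mem_univ, if_true]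
  have heven : Even ((μ t - 1) * (1 + pL n m t * pL n m t)) := by
    by_cases hp : pL n m t = 0
    · have := hμ t hp
      have : μ t - 1 = 0 := by omega
      simp [this]
    · have : pL n m t = 1 := by
        rcases t with i | i
        · simp [pL] at hp
        · simp [pL]
      simp [this]
  rw [← pow_add, Even.neg_one_pow]
  rw [← add_assoc]
  exact Even.add ⟨_, rfl⟩ heven

noncomputable section

/-- the pairs of basis vectors with `[X₀, s] = t` -/
def arrows (n m : ℕ) : Finset ((Fin (n + 1) ⊕ Fin m) × (Fin (n + 1) ⊕ Fin m)) :=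
  univ.filter fun a => Arrow n m a.1 a.2

/-- the coefficients of the raising operator -/
def raiseCoeff (n m : ℕ) (b : Fin (n + 1) ⊕ Fin m) : ℤ :=
  pos n m b * (len n m b - pos n m b)

/-- the raising operator completing `D` to an `sl₂`-triple -/
def raise (F : Type*) [Field F] (n m : ℕ) :
    Cochain F (Fin (n + 1) ⊕ Fin m) →ₗ[F] Cochain F (Fin (n + 1) ⊕ Fin m) :=
  ∑ a ∈ arrows n m, (raiseCoeff n m a.1 : F) • hop F (pL n m) a.1 a.2

/-- the weight of a monomial -/
def weight (n m : ℕ) (μ : Fin (n + 1) ⊕ Fin m → ℕ) : ℤ :=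
  ∑ b, (μ b : ℤ) * (len n m b + 1 - 2 * pos n m b)

end

lemma mem_arrows {a : (Fin (n + 1) ⊕ Fin m) × (Fin (n + 1) ⊕ Fin m)} :
    a ∈ arrows n m ↔ Arrow n m a.1 a.2 := by
  simp [arrows]

lemma D_single {μ : Fin (n + 1) ⊕ Fin m → ℕ} (hμ : IsAdm (pL n m) μ) :
    D F (pL n m) (ordL n m) (cL F n m) (Sum.inl 0) (Finsupp.single μ 1) =
      ∑ a ∈ arrows n m, hop F (pL n m) a.2 a.1 (Finsupp.single μ 1) := by
  have h1 : D F (pL n m) (ordL n m) (cL F n m) (Sum.inl 0) (Finsupp.single μ 1) =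
      DMono F (pL n m) (ordL n m) (cL F n m) (Sum.inl 0) μ := by
    simp [D, LinearMap.toSpanSingleton_apply]
  rw [h1, DMono, arrows, Finset.sum_filter, ← Finset.univ_product_univ, Finset.sum_product_right]
  refine Finset.sum_congr rfl fun b _ => Finset.sum_congr rfl fun j _ => ?_
  rw [cL_eq]
  by_cases hA : Arrow n m j b
  · simp only [if_pos hA]
    rw [hop_single, mul_assoc, hA.koszul_sign hμ]
    by_cases hb : μ b = 0
    · simp [hb]
    · simp [hb]
  · simp [hA]

lemma weight_Dtgt_of_arrow {s t : Fin (n + 1) ⊕ Fin m} (h : Arrow n m s t)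
    {μ : Fin (n + 1) ⊕ Fin m → ℕ} (ht : μ t ≠ 0) :
    weight n m (Dtgt μ t s) = weight n m μ + 2 := by
  rw [weight, sum_Dtgt_mul _ s ht, weight, len_eq_of_pL h.1, h.2.1]
  push_cast
  ring

lemma weight_Dtgt_of_arrow_symm {s t : Fin (n + 1) ⊕ Fin m} (h : Arrow n m s t)
    {μ : Fin (n + 1) ⊕ Fin m → ℕ} (hs : μ s ≠ 0) :
    weight n m (Dtgt μ s t) = weight n m μ - 2 := by
  rw [weight, sum_Dtgt_mul _ t hs, weight, len_eq_of_pL h.1, h.2.1]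
  push_cast
  ring

lemma exists_arrow_from {s : Fin (n + 1) ⊕ Fin m} (h : raiseCoeff n m s ≠ 0) :
    ∃ t, Arrow n m s t := by
  rcases s with i | i
  · simp only [raiseCoeff, pos, len, Sum.elim_inl, ne_eq, mul_eq_zero, not_or] at h
    have := i.2
    refine ⟨Sum.inl ⟨i + 1, by omega⟩, ?_⟩
    simp only [Arrow, pL, pos, Sum.elim_inl, true_and]
    omega
  · simp [raiseCoeff, pos, len] at h
    have := i.2
    refine ⟨Sum.inr ⟨i + 1, by omega⟩, ?_⟩
    simp [Arrow, pL, pos]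

lemma exists_arrow_to {t : Fin (n + 1) ⊕ Fin m} (h : 2 ≤ pos n m t) : ∃ s, Arrow n m s t := by
  rcases t with i | i
  · simp [pos] at h
    have := i.2
    refine ⟨Sum.inl ⟨i - 1, by omega⟩, ?_⟩
    simp [Arrow, pL, pos]
    omega
  · simp [pos] at h
    have := i.2
    refine ⟨Sum.inr ⟨i - 1, by omega⟩, ?_⟩
    simp [Arrow, pL, pos]
    omega

lemma sum_arrows_source (g : Fin (n + 1) ⊕ Fin m → ℤ) :
    ∑ a ∈ arrows n m, raiseCoeff n m a.1 * g a.1 = ∑ b, raiseCoeff n m b * g b := by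
  refine Finset.sum_bij_ne_zero (fun a _ _ => a.1) (fun _ _ _ => Finset.mem_univ _) ?_ ?_ ?_
  · intro a ha _ b hb _ hab
    rw [mem_arrows] at ha hb
    exact Prod.ext hab ((ha.source_eq_iff hb).1 hab)
  · intro s _ hs
    obtain ⟨t, ht⟩ := exists_arrow_from (left_ne_zero_of_mul hs)
    exact ⟨(s, t), mem_arrows.2 ht, hs, rfl⟩
  · intros; rfl

lemma sum_arrows_target {g : Fin (n + 1) ⊕ Fin m → ℤ} (hg : g (Sum.inl 0) = 0) :
    ∑ a ∈ arrows n m, raiseCoeff n m a.1 * g a.2 =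
      ∑ b, ((pos n m b - 1 : ℤ) * (len n m b - pos n m b + 1)) * g b := by
  have hval : ∀ s t, Arrow n m s t →
      raiseCoeff n m s = (pos n m t - 1 : ℤ) * (len n m t - pos n m t + 1) := by
    intro s t h
    rw [raiseCoeff, len_eq_of_pL h.1, h.2.1]
    push_cast
    ring
  refine Finset.sum_bij_ne_zero (fun a _ _ => a.2) (fun _ _ _ => Finset.mem_univ _) ?_ ?_ ?_
  · intro a ha _ b hb _ hab
    rw [mem_arrows] at ha hb
    exact Prod.ext ((ha.source_eq_iff hb).2 hab) hab
  · intro t _ ht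
    have h2 : 2 ≤ pos n m t := by
      by_contra hlt
      have h0 : t ≠ Sum.inl 0 := by
        rintro rfl
        simp [hg] at ht
      have : pos n m t ≠ 1 := by
        intro h
        simp [h] at ht
      have h00 : pos n m t = 0 := by omega
      rcases t with i | i
      · simp only [pos, Sum.elim_inl] at h00
        exact h0 (congrArg _ (Fin.ext h00))
      · simp [pos] at h00
    obtain ⟨s, hs⟩ := exists_arrow_to h2
    refine ⟨(s, t), mem_arrows.2 hs, ?_, rfl⟩
    rwa [hval s t hs]
  · intro a ha _
    rw [hval a.1 a.2 (mem_arrows.1 ha)]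

lemma sum_arrows_eq_weight {μ : Fin (n + 1) ⊕ Fin m → ℕ} (h0 : μ (Sum.inl 0) = 0) :
    ∑ a ∈ arrows n m, raiseCoeff n m a.1 * (μ a.1 - μ a.2 : ℤ) = weight n m μ := by
  simp only [mul_sub, Finset.sum_sub_distrib]
  rw [sum_arrows_source fun b => (μ b : ℤ), sum_arrows_target (g := fun b => (μ b : ℤ))
    (by simp [h0]), ← Finset.sum_sub_distrib, weight]
  refine Finset.sum_congr rfl fun b _ => ?_
  rw [raiseCoeff]
  ring

end Paper

namespace Paper
open SuperCE Finset

variable {F : Type*} [Field F] {n m : ℕ}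

/-- the lowering operator, which agrees with `D` on `Λᵏ I*` -/
noncomputable def lower (F : Type*) [Field F] (n m : ℕ) :
    Cochain F (Fin (n + 1) ⊕ Fin m) →ₗ[F] Cochain F (Fin (n + 1) ⊕ Fin m) :=
  ∑ a ∈ arrows n m, hop F (pL n m) a.2 a.1

lemma lower_eq_D {f : Cochain F (Fin (n + 1) ⊕ Fin m)} {k : ℕ}
    (hf : f ∈ IDeg F (pL n m) (Sum.inl 0) k) :
    D F (pL n m) (ordL n m) (cL F n m) (Sum.inl 0) f = lower F n m f := by
  rw [← Finsupp.sum_single f, Finsupp.sum, map_sum, map_sum]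
  refine Finset.sum_congr rfl fun μ hμ => ?_
  rw [Finsupp.mem_support_iff] at hμ
  rw [← mul_one (f μ), ← smul_eq_mul, ← Finsupp.smul_single, map_smul, map_smul,
    D_single (hf.1 μ hμ).1, lower, LinearMap.sum_apply]

lemma lower_mem_IDeg {k : ℕ} : ∀ f ∈ IDeg F (pL n m) (Sum.inl 0) k,
    lower F n m f ∈ IDeg F (pL n m) (Sum.inl 0) k := by
  refine linearMap_mem_IDeg fun μ _ h2 h3 => ?_
  rw [lower, LinearMap.sum_apply]
  exact Submodule.sum_mem _ fun a ha =>
    hop_single_mem_IDeg (mem_arrows.1 ha).source_ne h2 h3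

lemma raise_mem_IDeg {k : ℕ} : ∀ f ∈ IDeg F (pL n m) (Sum.inl 0) k,
    raise F n m f ∈ IDeg F (pL n m) (Sum.inl 0) k := by
  refine linearMap_mem_IDeg fun μ _ h2 h3 => ?_
  rw [raise, LinearMap.sum_apply]
  exact Submodule.sum_mem _ fun a ha => Submodule.smul_mem _ _
    (hop_single_mem_IDeg (mem_arrows.1 ha).target_ne h2 h3)

lemma diag_mem_IDeg {k : ℕ} (wt : (Fin (n + 1) ⊕ Fin m → ℕ) → ℤ) :
    ∀ f ∈ IDeg F (pL n m) (Sum.inl 0) k,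
    diag F wt f ∈ IDeg F (pL n m) (Sum.inl 0) k := by
  refine linearMap_mem_IDeg fun μ h1 h2 h3 => ?_
  rw [diag_single]
  exact single_mem_IDeg _ h1 h2 h3

lemma lower_raise_single {μ : Fin (n + 1) ⊕ Fin m → ℕ} (hμ : IsAdm (pL n m) μ)
    (h0 : μ (Sum.inl 0) = 0) :
    lower F n m (raise F n m (Finsupp.single μ 1)) -
      raise F n m (lower F n m (Finsupp.single μ 1)) =
      diag F (weight n m) (Finsupp.single μ 1) := by
  have key : ∀ a ∈ arrows n m, ∀ b ∈ arrows n m,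
      hop F (pL n m) b.2 b.1 (hop F (pL n m) a.1 a.2 (Finsupp.single μ 1)) -
        hop F (pL n m) a.1 a.2 (hop F (pL n m) b.2 b.1 (Finsupp.single μ 1)) =
      if b = a then Finsupp.single μ ((μ a.1 - μ a.2 : ℤ) : F) else 0 := by
    intro a ha b hb
    rw [mem_arrows] at ha hb
    split_ifs with hab
    · subst hab
      exact hop_commutator_single hμ ha.ne ha.1
    · have h1 : b.1 ≠ a.1 := fun h => hab (Prod.ext h ((hb.source_eq_iff ha).1 h))
      have h2 : b.2 ≠ a.2 := fun h => hab (Prod.ext ((hb.source_eq_iff ha).2 h) h)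
      rw [hop_commute_single hμ hb.ne ha.ne h1 h2 hb.1 ha.1, sub_self]
  have h1 : lower F n m (raise F n m (Finsupp.single μ 1)) =
      ∑ a ∈ arrows n m, ∑ b ∈ arrows n m, (raiseCoeff n m a.1 : F) •
        hop F (pL n m) b.2 b.1 (hop F (pL n m) a.1 a.2 (Finsupp.single μ 1)) := by
    rw [raise, LinearMap.sum_apply, map_sum]
    refine Finset.sum_congr rfl fun a _ => ?_
    rw [LinearMap.smul_apply, map_smul, lower, LinearMap.sum_apply, Finset.smul_sum]
  have h2 : raise F n m (lower F n m (Finsupp.single μ 1)) =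
      ∑ a ∈ arrows n m, ∑ b ∈ arrows n m, (raiseCoeff n m a.1 : F) •
        hop F (pL n m) a.1 a.2 (hop F (pL n m) b.2 b.1 (Finsupp.single μ 1)) := by
    rw [raise, LinearMap.sum_apply]
    refine Finset.sum_congr rfl fun a _ => ?_
    rw [LinearMap.smul_apply, lower, LinearMap.sum_apply, map_sum, Finset.smul_sum]
  rw [h1, h2, diag_single, ← sum_arrows_eq_weight h0, one_mul, Int.cast_sum, Finsupp.single_finsetSum,
    ← Finset.sum_sub_distrib]
  refine Finset.sum_congr rfl fun a ha => ?_
  rw [← Finset.sum_sub_distrib, Finset.sum_congr rfl fun b hb => by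
    rw [← smul_sub, key a ha b hb]]
  simp only [smul_ite, smul_zero, Finset.sum_ite_eq', if_pos ha, Finsupp.smul_single,
    smul_eq_mul, Int.cast_mul]

lemma diag_hop_single {b j : Fin (n + 1) ⊕ Fin m} {μ : Fin (n + 1) ⊕ Fin m → ℕ} {c : ℤ}
    (h : μ b ≠ 0 → weight n m (Dtgt μ b j) = weight n m μ + c) :
    diag F (weight n m) (hop F (pL n m) b j (Finsupp.single μ 1)) -
      hop F (pL n m) b j (diag F (weight n m) (Finsupp.single μ 1)) =
      (c : F) • hop F (pL n m) b j (Finsupp.single μ 1) := by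
  rw [diag_single, hop_single, hop_single]
  split_ifs
  · by_cases hb : μ b = 0
    · simp [hb]
    · rw [diag_single, h hb, ← Finsupp.single_sub, Finsupp.smul_single]
      congr 1
      push_cast
      simp only [smul_eq_mul]
      ring
  · simp

lemma diag_lower_single (μ : Fin (n + 1) ⊕ Fin m → ℕ) :
    diag F (weight n m) (lower F n m (Finsupp.single μ 1)) -
      lower F n m (diag F (weight n m) (Finsupp.single μ 1)) =
      (2 : F) • lower F n m (Finsupp.single μ 1) := by
  simp only [lower, LinearMap.sum_apply, map_sum, ← Finset.sum_sub_distrib, Finset.smul_sum]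
  refine Finset.sum_congr rfl fun a ha => ?_
  simpa using diag_hop_single (F := F) (weight_Dtgt_of_arrow (μ := μ) (mem_arrows.1 ha))

lemma diag_raise_single (μ : Fin (n + 1) ⊕ Fin m → ℕ) :
    diag F (weight n m) (raise F n m (Finsupp.single μ 1)) -
      raise F n m (diag F (weight n m) (Finsupp.single μ 1)) =
      -((2 : F) • raise F n m (Finsupp.single μ 1)) := by
  simp only [raise, LinearMap.sum_apply, map_sum, ← Finset.sum_sub_distrib, Finset.smul_sum,
    LinearMap.smul_apply, map_smul, ← smul_sub, ← Finset.sum_neg_distrib]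
  refine Finset.sum_congr rfl fun a ha => ?_
  have h := diag_hop_single (F := F) (c := -2)
    (weight_Dtgt_of_arrow_symm (μ := μ) (mem_arrows.1 ha))
  rw [h, smul_comm, ← neg_smul]
  norm_num

lemma finrank_KerD [CharZero F] (k : ℕ) :
    Module.finrank F ↥(KerD F (pL n m) (ordL n m) (cL F n m) (Sum.inl 0) k) =
      Set.ncard {μ : Fin (n + 1) ⊕ Fin m → ℕ | (IsAdm (pL n m) μ ∧ deg μ = k ∧
        μ (Sum.inl 0) = 0) ∧ (weight n m μ = 0 ∨ weight n m μ = 1)} := by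
  have hker : KerD F (pL n m) (ordL n m) (cL F n m) (Sum.inl 0) k =
      IDeg F (pL n m) (Sum.inl 0) k ⊓ LinearMap.ker (lower F n m) := by
    ext x
    refine and_congr_right fun hx => ?_
    rw [SetLike.mem_coe, SetLike.mem_coe, LinearMap.mem_ker, LinearMap.mem_ker, lower_eq_D hx]
  have : Fintype {μ : Fin (n + 1) ⊕ Fin m → ℕ | IsAdm (pL n m) μ ∧ deg μ = k ∧ μ (Sum.inl 0) = 0} :=
    (finite_monomials _ _).fintype
  rw [hker, SlTwo.finrank_inf_ker (monomialBasis F (pL n m) (Sum.inl 0) k) lower_mem_IDeg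
    raise_mem_IDeg (diag_mem_IDeg (weight n m)) (wt := fun μ => weight n m μ.1)]
  · rw [← Set.ncard_coe_finset, ← Subtype.val_injective.injOn.ncard_image]
    congr 1
    ext μ
    simp only [Set.mem_image, mem_coe, Set.mem_ofPred_eq]
    constructor
    · rintro ⟨i, hi, rfl⟩
      exact ⟨i.2, (mem_filter.1 hi).2⟩
    · rintro ⟨h1, h2⟩
      exact ⟨⟨μ, h1⟩, mem_filter.2 ⟨@mem_univ _ this _, h2⟩, rfl⟩
  · intro i
    rw [coe_monomialBasis]
    exact lower_raise_single i.2.1 i.2.2.2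
  · intro i
    rw [coe_monomialBasis]
    exact diag_lower_single i.1
  · intro i
    rw [coe_monomialBasis]
    exact diag_raise_single i.1
  · intro i
    rw [coe_monomialBasis, diag_single, Finsupp.smul_single, smul_eq_mul, mul_comm]

end Paper

namespace Paper
open Finset

lemma sum_piAntidiag_insert_succ {i : ℕ} {s : Finset ℕ} (hi : i ∉ s) (b : ℕ)
    (G : (ℕ → ℕ) → ℕ) :
    ∑ ν ∈ (insert i s).piAntidiag (b + 1), G ν =
      ∑ ν ∈ s.piAntidiag (b + 1), G ν +
        ∑ ν ∈ (insert i s).piAntidiag b, G (ν + Pi.single i 1) := by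
  rw [← Finset.sum_filter_add_sum_filter_not _ fun ν : ℕ → ℕ => ν i = 0]
  congr 1
  · refine Finset.sum_congr ?_ fun _ _ => rfl
    ext ν
    have hsum : (insert i s).sum ν = ν i + s.sum ν := sum_insert hi
    simp only [mem_filter, mem_piAntidiag, hsum, mem_insert]
    constructor
    · rintro ⟨⟨h1, h2⟩, h3⟩
      refine ⟨by omega, fun j hj => (h2 j hj).resolve_left ?_⟩
      rintro rfl
      exact hj h3
    · rintro ⟨h1, h2⟩
      have h3 : ν i = 0 := by
        by_contra h
        exact hi (h2 i h)
      exact ⟨⟨by omega, fun j hj => Or.inr (h2 j hj)⟩, h3⟩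
  · have hs : ∀ ν : ℕ → ℕ, (insert i s).sum (ν + Pi.single i 1) = (insert i s).sum ν + 1 := by
      intro ν
      simp [Finset.sum_add_distrib, Finset.sum_pi_single']
    refine (Finset.sum_nbij (fun ν => ν + Pi.single i 1) ?_ ?_ ?_ fun _ _ => rfl).symm
    · intro ν hν
      rw [mem_piAntidiag] at hν
      rw [mem_filter, mem_piAntidiag]
      refine ⟨⟨by rw [hs, hν.1], fun j hj => ?_⟩, by simp⟩
      by_cases hji : j = i
      · exact hji ▸ mem_insert_self _ _
      · exact hν.2 j (by simpa [hji] using hj)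
    · exact fun ν _ ν' _ h => add_right_cancel h
    · intro ν hν
      rw [mem_coe, mem_filter, mem_piAntidiag] at hν
      have hν' : ν - Pi.single i 1 + Pi.single i 1 = ν := by
        funext j
        by_cases hji : j = i
        · subst hji
          simp
          omega
        · simp [hji]
      refine ⟨ν - Pi.single i 1, ?_, hν'⟩
      rw [mem_coe, mem_piAntidiag]
      constructor
      · have := hs (ν - Pi.single i 1)
        rw [hν', hν.1.1] at this
        omega
      · intro j hj
        exact hν.1.2 j fun h => hj (by simp [h])

/-- stars and bars: a multiset of size `b` in `{1, …, m}` corresponds to a subset of size `b` of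
`{1, …, m + b - 1}` whose sum is larger by `b (b - 1) / 2` -/
lemma sum_piAntidiag_eq_sum_powersetCard (m b : ℕ) (g : ℕ → ℕ) :
    ∑ ν ∈ (Icc 1 m).piAntidiag b, g (∑ j ∈ Icc 1 m, j * ν j + b * (b - 1) / 2) =
      ∑ T ∈ powersetCard b (Icc 1 (m + b - 1)), g (T.sum id) := by
  induction m generalizing b g with
  | zero =>
    cases b with
    | zero => simp
    | succ b =>
      rw [powersetCard_eq_empty.2 (by simp)]
      simp
  | succ m ihm =>
    induction b generalizing g with
    | zero => simp
    | succ b ihb =>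
      have hIcc : Icc 1 (m + 1 + (b + 1) - 1) = insert (m + b + 1) (Icc 1 (m + b)) := by
        ext x; simp; omega
      have hIcc' : Icc 1 (m + 1) = insert (m + 1) (Icc 1 m) := by
        ext x; simp; omega
      have hnot : m + b + 1 ∉ Icc 1 (m + b) := by simp
      have hnot' : m + 1 ∉ Icc 1 m := by simp
      have hb : (b + 1) * (b + 1 - 1) / 2 = b * (b - 1) / 2 + b := by
        rw [Nat.add_sub_cancel, ← Nat.add_mul_div_left _ _ (by norm_num : 0 < 2)]
        congr 1
        cases b
        · simp
        · simp; ring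
      have hdisj : Disjoint (powersetCard (b + 1) (Icc 1 (m + b)))
          ((powersetCard b (Icc 1 (m + b))).image (insert (m + b + 1))) := by
        rw [Finset.disjoint_left]
        intro T hT hT'
        obtain ⟨S, -, rfl⟩ := mem_image.1 hT'
        exact hnot ((mem_powersetCard.1 hT).1 (mem_insert_self _ _))
      have hinj : Set.InjOn (insert (m + b + 1)) (powersetCard b (Icc 1 (m + b)) : Set (Finset ℕ)) := by
        intro S hS T hT h
        have hS' : m + b + 1 ∉ S := fun h => hnot ((mem_powersetCard.1 hS).1 h)
        have hT' : m + b + 1 ∉ T := fun h => hnot ((mem_powersetCard.1 hT).1 h)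
        rw [← erase_insert hS', h, erase_insert hT']
      rw [hIcc, powersetCard_succ_insert hnot, sum_union hdisj, sum_image hinj]
      have h1 := ihm (b + 1) g
      have h2 := ihb fun x => g (x + (m + b + 1))
      rw [show m + (b + 1) - 1 = m + b by omega] at h1
      rw [show m + 1 + b - 1 = m + b by omega] at h2
      have h3 : ∀ T ∈ powersetCard b (Icc 1 (m + b)),
          g ((insert (m + b + 1) T).sum id) = g (T.sum id + (m + b + 1)) := by
        intro T hT
        rw [sum_insert fun h => hnot ((mem_powersetCard.1 hT).1 h), add_comm, id_eq]
      rw [← h1, Finset.sum_congr rfl h3, ← h2, hIcc', sum_piAntidiag_insert_succ hnot']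
      congr 1
      · refine Finset.sum_congr rfl fun ν hν => ?_
        have : ν (m + 1) = 0 := by
          by_contra h
          exact hnot' ((mem_piAntidiag.1 hν).2 _ h)
        rw [sum_insert hnot', this, mul_zero, zero_add]
      · refine Finset.sum_congr rfl fun ν _ => congrArg g ?_
        have : ∑ j ∈ insert (m + 1) (Icc 1 m), j * (ν + Pi.single (m + 1) 1 : ℕ → ℕ) j =
            ∑ j ∈ insert (m + 1) (Icc 1 m), j * ν j + (m + 1) := by
          simp only [Pi.add_apply, mul_add, Finset.sum_add_distrib, Pi.single_apply]
          simp
        rw [this, hb]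
        ring

end Paper

namespace Paper
open SuperCE Finset

variable {n m : ℕ}

noncomputable section

/-- the exponent vector of the monomial with even part the subset `A` of `{1, …, n}` and odd part
the multiset of elements of `{1, …, m}` with multiplicities `ν` -/
def expVec (n m : ℕ) (x : Finset ℕ × (ℕ → ℕ)) : Fin (n + 1) ⊕ Fin m → ℕ :=
  Sum.elim (fun i => if (i : ℕ) ∈ x.1 then 1 else 0) (fun j => x.2 (j + 1))

/-- pairs of a subset of `{1, …, n}` of size `a` and a multiset in `{1, …, m}` of size `b` of
prescribed total sum -/
def subMultisets (n m a b : ℕ) : Finset (Finset ℕ × (ℕ → ℕ)) :=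
  (((Icc 1 n).powersetCard a) ×ˢ ((Icc 1 m).piAntidiag b)).filter fun x =>
    x.1.sum id + ∑ j ∈ Icc 1 m, j * x.2 j = (a * (n + 1) + b * (m + 1)) / 2

end

lemma fnm_eq_card_subMultisets (a b : ℕ) : fnm n m a b = #(subMultisets n m a b) := by
  rw [fnm, subMultisets, card_filter, card_filter, sum_product, sum_product]
  refine Finset.sum_congr rfl fun A _ => ?_
  rw [← sum_piAntidiag_eq_sum_powersetCard m b fun s => if A.sum id + s =
    (a * (n + 1) + b * (m + 1)) / 2 + b * (b - 1) / 2 then 1 else 0]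
  refine Finset.sum_congr rfl fun ν _ => if_congr ?_ rfl rfl
  rw [← add_assoc, Nat.add_right_cancel_iff]

lemma sum_expVec_mul {A : Finset ℕ} (hA : A ⊆ Icc 1 n) (ν : ℕ → ℕ)
    (g h : ℕ → ℤ) :
    ∑ b, (expVec n m (A, ν) b : ℤ) * Sum.elim (fun i : Fin (n + 1) => g i)
        (fun j : Fin m => h (j + 1)) b =
      ∑ i ∈ A, g i + ∑ j ∈ Icc 1 m, ν j * h j := by
  rw [Fintype.sum_sum_type]
  simp only [expVec, Sum.elim_inl, Sum.elim_inr]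
  congr 1
  · rw [Fin.sum_univ_eq_sum_range fun i => ((if i ∈ A then 1 else 0 : ℕ) : ℤ) * g i]
    have hA' : A = (range (n + 1)).filter (· ∈ A) := by
      ext i
      have := @hA i
      simp only [mem_Icc] at this
      simp only [mem_filter, mem_range]
      grind
    conv_rhs => rw [hA', Finset.sum_filter]
    refine Finset.sum_congr rfl fun i _ => ?_
    split_ifs <;> simp
  · rw [Fin.sum_univ_eq_sum_range fun j => (ν (j + 1) : ℤ) * h (j + 1), Finset.range_eq_Ico,
      Finset.sum_Ico_add' fun j => (ν j : ℤ) * h j]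
    rfl

lemma isAdm_expVec (x : Finset ℕ × (ℕ → ℕ)) : IsAdm (pL n m) (expVec n m x) := by
  rintro (i | j) h
  · simp only [expVec, Sum.elim_inl]
    split_ifs <;> simp
  · simp [pL] at h

lemma expVec_zero {A : Finset ℕ} (hA : A ⊆ Icc 1 n) (ν : ℕ → ℕ) :
    expVec n m (A, ν) (Sum.inl 0) = 0 := by
  have : 0 ∉ A := fun h => by simpa using hA h
  simp [expVec, this]

lemma deg_expVec {A : Finset ℕ} (hA : A ⊆ Icc 1 n) (ν : ℕ → ℕ) :
    deg (expVec n m (A, ν)) = #A + ∑ j ∈ Icc 1 m, ν j := by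
  have h := sum_expVec_mul (m := m) hA ν (fun _ => 1) fun _ => 1
  have h1 : Sum.elim (fun _ : Fin (n + 1) => (1 : ℤ)) (fun _ : Fin m => 1) = fun _ => 1 := by
    funext b
    cases b <;> rfl
  rw [h1] at h
  simp only [mul_one, Finset.sum_const, nsmul_eq_mul] at h
  exact_mod_cast h

lemma weight_expVec {A : Finset ℕ} (hA : A ⊆ Icc 1 n) (ν : ℕ → ℕ) :
    weight n m (expVec n m (A, ν)) =
      ((#A * (n + 1) + (∑ j ∈ Icc 1 m, ν j) * (m + 1) : ℕ) : ℤ) -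
        2 * (A.sum id + ∑ j ∈ Icc 1 m, j * ν j : ℕ) := by
  have h := sum_expVec_mul (m := m) hA ν (fun i => n + 1 - 2 * i) fun j => m + 1 - 2 * j
  have h1 : Sum.elim (fun i : Fin (n + 1) => (n + 1 - 2 * (i : ℕ) : ℤ))
      (fun j : Fin m => m + 1 - 2 * ((j + 1 : ℕ) : ℤ)) =
      fun b => (len n m b + 1 - 2 * pos n m b : ℤ) := by
    funext b
    cases b <;> simp [len, pos]
  rw [h1] at h
  rw [weight, h]
  push_cast
  simp only [Finset.sum_sub_distrib, Finset.sum_const, nsmul_eq_mul, mul_sub, id_eq, mul_add,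
    Finset.sum_mul, Finset.mul_sum, Finset.sum_add_distrib]
  have : ∀ j : ℕ, (ν j : ℤ) * (2 * j) = 2 * (j * ν j) := fun j => by ring
  simp only [this]
  ring

lemma exists_expVec_eq {μ : Fin (n + 1) ⊕ Fin m → ℕ} (hμ : IsAdm (pL n m) μ)
    (h0 : μ (Sum.inl 0) = 0) : ∃ A ⊆ Icc 1 n, ∃ ν : ℕ → ℕ, (∀ j, ν j ≠ 0 → j ∈ Icc 1 m) ∧
      expVec n m (A, ν) = μ := by
  refine ⟨(univ.filter fun i => μ (Sum.inl i) ≠ 0).image Fin.val, ?_,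
    fun j => if h : 1 ≤ j ∧ j ≤ m then μ (Sum.inr ⟨j - 1, by omega⟩) else 0, ?_, ?_⟩
  · intro i hi
    obtain ⟨i, hμi, rfl⟩ := mem_image.1 hi
    have hne : i ≠ 0 := by
      rintro rfl
      exact (mem_filter.1 hμi).2 h0
    have : (i : ℕ) ≠ 0 := fun h => hne (Fin.ext h)
    have := i.2
    rw [mem_Icc]
    omega
  · intro j hj
    rw [mem_Icc]
    by_contra h
    exact hj (dif_neg h)
  · funext b
    rcases b with i | j
    · have := hμ (Sum.inl i) rfl
      by_cases hi : μ (Sum.inl i) = 0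
      · simp [expVec, hi, Fin.val_inj]
      · simp [expVec, hi, Fin.val_inj]
        omega
    · have := j.2
      simp [expVec]

lemma expVec_inj {A A' : Finset ℕ} {ν ν' : ℕ → ℕ} (hA : A ⊆ Icc 1 n) (hA' : A' ⊆ Icc 1 n)
    (hν : ∀ j, ν j ≠ 0 → j ∈ Icc 1 m) (hν' : ∀ j, ν' j ≠ 0 → j ∈ Icc 1 m)
    (h : expVec n m (A, ν) = expVec n m (A', ν')) : A = A' ∧ ν = ν' := by
  constructor
  · ext i
    by_cases hi : i ∈ Icc 1 n
    · have hi' : i < n + 1 := by rw [mem_Icc] at hi; omega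
      have := congrFun h (Sum.inl ⟨i, hi'⟩)
      simp only [expVec, Sum.elim_inl] at this
      split_ifs at this <;> tauto
    · exact iff_of_false (fun h => hi (hA h)) fun h => hi (hA' h)
  · funext j
    by_cases hj : j ∈ Icc 1 m
    · rw [mem_Icc] at hj
      have := congrFun h (Sum.inr ⟨j - 1, by omega⟩)
      simpa [expVec, Nat.sub_add_cancel hj.1] using this
    · rw [not_imp_comm.1 (hν j) hj, not_imp_comm.1 (hν' j) hj]

lemma mem_subMultisets {a b : ℕ} {A : Finset ℕ} {ν : ℕ → ℕ} :
    (A, ν) ∈ subMultisets n m a b ↔ A ⊆ Icc 1 n ∧ (∀ j, ν j ≠ 0 → j ∈ Icc 1 m) ∧ #A = a ∧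
      ∑ j ∈ Icc 1 m, ν j = b ∧
      A.sum id + ∑ j ∈ Icc 1 m, j * ν j = (a * (n + 1) + b * (m + 1)) / 2 := by
  simp only [subMultisets, mem_filter, mem_product, mem_powersetCard, mem_piAntidiag]
  tauto

lemma ncard_weight_zero_or_one (k : ℕ) :
    Set.ncard {μ : Fin (n + 1) ⊕ Fin m → ℕ | (IsAdm (pL n m) μ ∧ deg μ = k ∧
        μ (Sum.inl 0) = 0) ∧ (weight n m μ = 0 ∨ weight n m μ = 1)} =
      ∑ a ∈ range (k + 1), fnm n m a (k - a) := by
  have himage : {μ : Fin (n + 1) ⊕ Fin m → ℕ | (IsAdm (pL n m) μ ∧ deg μ = k ∧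
      μ (Sum.inl 0) = 0) ∧ (weight n m μ = 0 ∨ weight n m μ = 1)} =
      expVec n m '' ((range (k + 1)).biUnion fun a => subMultisets n m a (k - a)) := by
    ext μ
    simp only [Set.mem_ofPred_eq, Set.mem_image, mem_coe, mem_biUnion, mem_range, Prod.exists,
      mem_subMultisets]
    constructor
    · rintro ⟨⟨h1, h2, h3⟩, h4⟩
      obtain ⟨A, hA, ν, hν, rfl⟩ := exists_expVec_eq h1 h3
      rw [deg_expVec hA] at h2
      rw [weight_expVec hA] at h4
      have h5 : ∑ j ∈ Icc 1 m, ν j = k - #A := by omega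
      rw [h5] at h4
      exact ⟨A, ν, ⟨#A, by omega, hA, hν, rfl, h5, by omega⟩, rfl⟩
    · rintro ⟨A, ν, ⟨a, ha, hA, hν, rfl, h1, h2⟩, rfl⟩
      refine ⟨⟨isAdm_expVec _, by rw [deg_expVec hA, h1]; omega, expVec_zero hA ν⟩, ?_⟩
      rw [weight_expVec hA, h1]
      omega
  have hinj : Set.InjOn (expVec n m)
      ((range (k + 1)).biUnion fun a => subMultisets n m a (k - a)) := by
    rintro ⟨A, ν⟩ hx ⟨A', ν'⟩ hx' h
    simp only [mem_coe, mem_biUnion, mem_subMultisets] at hx hx'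
    obtain ⟨a, -, hA, hν, -⟩ := hx
    obtain ⟨a', -, hA', hν', -⟩ := hx'
    obtain ⟨rfl, rfl⟩ := expVec_inj hA hA' hν hν' h
    rfl
  rw [himage, hinj.ncard_image, Set.ncard_coe_finset, card_biUnion]
  · exact Finset.sum_congr rfl fun a _ => (fnm_eq_card_subMultisets a _).symm
  · intro a _ a' _ haa'
    rw [Function.onFun, Finset.disjoint_left]
    rintro ⟨A, ν⟩ h h'
    rw [mem_subMultisets] at h h'
    exact haa' (h.2.2.1.symm.trans h'.2.2.1)

end Paper
noncomputable section
namespace Paper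
open SuperCE Finset

/-- For the model filiform Lie superalgebra `L_{n,m}` in characteristic
zero, with `D_k` the operator `-X_0·` on `Λᵏ I*`, one has
`dim Ker D_k = ∑_{k₀=0}^{k} f_{n,m}(k₀, k-k₀)`. -/
theorem dim_ker_D_model_filiform
    (F : Type*) [Field F] [IsAlgClosed F] [CharZero F]
    (n m : ℕ) (hn : 1 ≤ n) (hm : 1 ≤ m) (k : ℕ) :
    Module.finrank F ↥(KerD F (pL n m) (ordL n m) (cL F n m) (Sum.inl 0) k) =
      ∑ k0 ∈ Finset.range (k + 1), fnm n m k0 (k - k0) := by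
  rw [finrank_KerD, ncard_weight_zero_or_one]

end Paper
end
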